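/- arXiv:0901.1649 — 2 statements merged into one kernel-verified Lean document; each statement's English description precedes it below -/
import Mathlib

section
/- Let F be a field of characteristic 2 with |F| > 2, either finite or algebraically closed. Fix d₁, d₂, d₃ ∈ F× with d₁ + d₂ + d₃ = 0, set Sᵢ = {(x, dᵢ/x) : x ∈ F×} and S = S₁ ∪ S₂ ∪ S₃. Then every element of F × F is a sum of two elements of S, and every element (u,v) ≠ (0,0) has at most 18 ordered representations as a sum of two elements of S. -/
open Polynomial in
lemma aux_AS {F : Type*} [Field F] [CharP F 2] (hF : Finite F ∨ IsAlgClosed F) (a b : F) :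
    (∃ t : F, t ^ 2 + t = a) ∨ (∃ t : F, t ^ 2 + t = b) ∨ (∃ t : F, t ^ 2 + t = a + b) := by
  have h2 : (2 : F) = 0 := CharTwo.two_eq_zero
  rcases hF with hF | hF
  · let f : F →+ F :=
      { toFun := fun t => t ^ 2 + t
        map_zero' := by simp
        map_add' := fun x y => by linear_combination (x * y) * h2 }
    have hker : Nat.card f.ker = 2 := by
      have : (f.ker : Set F) = {0, 1} := by
        ext x
        simp only [SetLike.mem_coe, AddMonoidHom.mem_ker, Set.mem_insert_iff,
          Set.mem_singleton_iff]
        change x ^ 2 + x = 0 ↔ _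
        constructor
        · intro h
          have : x * (x - 1) = 0 := by linear_combination h - x * h2
          rcases mul_eq_zero.1 this with h | h
          · exact Or.inl h
          · exact Or.inr (sub_eq_zero.1 h)
        · rintro (rfl | rfl)
          · simp
          · linear_combination h2
      have h3 : Nat.card (f.ker : Set F) = 2 := by
        rw [this, Nat.card_coe_set_eq, Set.ncard_pair zero_ne_one]
      exact h3
    have hidx : f.range.index = 2 := by
      have e1 := f.range.card_mul_index
      have e2 := f.ker.card_mul_index
      rw [AddSubgroup.index_ker, hker] at e2
      have hp : 0 < Nat.card f.range := Nat.card_pos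
      rw [← e2, mul_comm] at e1
      exact Nat.eq_of_mul_eq_mul_right hp e1
    have := AddSubgroup.add_mem_iff_of_index_two hidx (a := a) (b := b)
    simp only [AddMonoidHom.mem_range] at this
    change (∃ t : F, t ^ 2 + t = a + b) ↔ ((∃ t : F, t ^ 2 + t = a) ↔ (∃ t : F, t ^ 2 + t = b)) at this
    tauto
  · left
    have hd : (C 1 * X ^ 2 + C 1 * X + C (-a) : F[X]).degree = 2 :=
      degree_quadratic one_ne_zero
    obtain ⟨t, ht⟩ := IsAlgClosed.exists_root _ (by rw [hd]; decide)
    refine ⟨t, ?_⟩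
    simp [IsRoot] at ht
    linear_combination ht

lemma aux_rep {F : Type*} [Field F] [CharP F 2] (d u v t : F) (hd : d ≠ 0) (hu : u ≠ 0)
    (hv : v ≠ 0) (ht : t ^ 2 + t = d / (u * v)) :
    ∃ x y : F, x ≠ 0 ∧ y ≠ 0 ∧ x + y = u ∧ d / x + d / y = v := by
  have h2 : (2 : F) = 0 := CharTwo.two_eq_zero
  have hne : t * (t + 1) ≠ 0 := by
    have : t * (t + 1) = d / (u * v) := by rw [← ht]; ring
    rw [this]
    exact div_ne_zero hd (mul_ne_zero hu hv)
  have h0 : t ≠ 0 := left_ne_zero_of_mul hne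
  have h1 : t + 1 ≠ 0 := right_ne_zero_of_mul hne
  refine ⟨u * t, u * (t + 1), mul_ne_zero hu h0, mul_ne_zero hu h1,
    by linear_combination (u * t) * h2, ?_⟩
  rw [eq_div_iff (mul_ne_zero hu hv)] at ht
  rw [div_add_div _ _ (mul_ne_zero hu h0) (mul_ne_zero hu h1),
    div_eq_iff (mul_ne_zero (mul_ne_zero hu h0) (mul_ne_zero hu h1))]
  linear_combination (-u) * ht + (d * u * t) * h2

open Polynomial in
lemma aux_count {F : Type*} [Field F] (d : Fin 3 → F) (hd : ∀ i, d i ≠ 0) (S : Set (F × F))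
    (hS : ∀ q ∈ S, ∃ i, ∃ x : F, x ≠ 0 ∧ q = (x, d i / x)) (g : F × F) (hg : g ≠ (0, 0)) :
    Cardinal.mk {p : (F × F) × (F × F) // p.1 ∈ S ∧ p.2 ∈ S ∧ p.1 + p.2 = g} ≤ 18 := by
  classical
  obtain ⟨u, v⟩ := g
  let P : Fin 3 × Fin 3 → F[X] := fun k =>
    C (-v) * X ^ 2 + C (u * v + d k.1 - d k.2) * X + C (-(d k.1 * u))
  have hP : ∀ k, P k ≠ 0 := by
    intro k hk
    have c0 := congrArg (fun p => coeff p 0) hk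
    have c2 := congrArg (fun p => coeff p 2) hk
    simp [P, coeff_X, coeff_C, hd] at c0 c2
    exact hg (by simp [c0, c2])
  let A : Fin 3 × Fin 3 → Finset ((F × F) × (F × F)) := fun k =>
    (P k).roots.toFinset.image fun x => ((x, d k.1 / x), (u, v) - (x, d k.1 / x))
  let B : Finset ((F × F) × (F × F)) := Finset.univ.biUnion A
  have hB : B.card ≤ 18 := by
    have := Finset.card_biUnion_le_card_mul (Finset.univ : Finset (Fin 3 × Fin 3)) A 2 (by
      intro k _
      refine Finset.card_image_le.trans ((Multiset.toFinset_card_le _).trans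
        ((card_roots' _).trans natDegree_quadratic_le)))
    simpa using this
  have hsub : {p : (F × F) × (F × F) | p.1 ∈ S ∧ p.2 ∈ S ∧ p.1 + p.2 = (u, v)} ⊆
      (B : Set ((F × F) × (F × F))) := by
    rintro ⟨p, q⟩ ⟨hp, hq, hpq⟩
    simp only at hp hq hpq
    obtain ⟨i, x, hx, rfl⟩ := hS p hp
    obtain ⟨j, y, hy, rfl⟩ := hS q hq
    simp only [Prod.mk_add_mk, Prod.mk.injEq] at hpq
    obtain ⟨e1, e2⟩ := hpq
    have e3 : d i * y + x * d j = v * (x * y) := by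
      rwa [div_add_div _ _ hx hy, div_eq_iff (mul_ne_zero hx hy)] at e2
    simp only [B, A, Finset.coe_biUnion, Set.mem_iUnion, Finset.coe_image]
    refine ⟨(i, j), by simp, x, ?_, ?_⟩
    · rw [Finset.mem_coe, Multiset.mem_toFinset, mem_roots (hP _), IsRoot.def]
      simp only [P, eval_add, eval_mul, eval_C, eval_pow, eval_X]
      rw [← e1]
      linear_combination -e3
    · simp [← e1, ← e2]
  calc _ ≤ Cardinal.mk (B : Set ((F × F) × (F × F))) := Cardinal.mk_le_mk_of_subset hsub
    _ = (B.card : Cardinal) := Cardinal.mk_coe_finset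
    _ ≤ 18 := by exact_mod_cast hB


/-- for `F` of characteristic 2, `|F| > 2`, finite or
algebraically closed, the union `S = S₁ ∪ S₂ ∪ S₃` of the hyperbolas
`Sᵢ = {(x, dᵢ/x) : x ≠ 0}` (with `d₁ + d₂ + d₃ = 0`, `dᵢ ≠ 0`) is a basis of
`F × F`, and every `(u,v) ≠ (0,0)` has at most 18 ordered representations. -/
theorem stmt_14 {F : Type*} [Field F] [CharP F 2]
    (hbig : 2 < Cardinal.mk F) (hF : Finite F ∨ IsAlgClosed F)
    (d₁ d₂ d₃ : F) (h₁ : d₁ ≠ 0) (h₂ : d₂ ≠ 0) (h₃ : d₃ ≠ 0)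
    (hsum : d₁ + d₂ + d₃ = 0)
    (S : Set (F × F))
    (hS : S = {q | ∃ x : F, x ≠ 0 ∧ q = (x, d₁ / x)} ∪
              {q | ∃ x : F, x ≠ 0 ∧ q = (x, d₂ / x)} ∪
              {q | ∃ x : F, x ≠ 0 ∧ q = (x, d₃ / x)}) :
    (∀ g : F × F, ∃ a ∈ S, ∃ b ∈ S, a + b = g) ∧
    (∀ g : F × F, g ≠ (0, 0) →
      Cardinal.mk {p : (F × F) × (F × F) // p.1 ∈ S ∧ p.2 ∈ S ∧ p.1 + p.2 = g}
        ≤ 18) := by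
  have c2 : (2 : F) = 0 := CharTwo.two_eq_zero
  have m1 : ∀ x : F, x ≠ 0 → (x, d₁ / x) ∈ S := fun x hx => by
    rw [hS]; exact Or.inl (Or.inl ⟨x, hx, rfl⟩)
  have m2 : ∀ x : F, x ≠ 0 → (x, d₂ / x) ∈ S := fun x hx => by
    rw [hS]; exact Or.inl (Or.inr ⟨x, hx, rfl⟩)
  have m3 : ∀ x : F, x ≠ 0 → (x, d₃ / x) ∈ S := fun x hx => by
    rw [hS]; exact Or.inr ⟨x, hx, rfl⟩
  have e3 : d₃ = d₁ + d₂ := by linear_combination hsum - (d₁ + d₂) * c2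
  constructor
  · rintro ⟨u, v⟩
    by_cases hu : u = 0
    · subst hu
      by_cases hv : v = 0
      · subst hv
        exact ⟨_, m1 1 one_ne_zero, _, m1 1 one_ne_zero, by
          ext <;> simp [CharTwo.add_self_eq_zero]⟩
      · have hx : d₃ / v ≠ 0 := div_ne_zero h₃ hv
        refine ⟨_, m1 _ hx, _, m2 _ hx, ?_⟩
        ext
        · simp [CharTwo.add_self_eq_zero]
        · simp only [Prod.mk_add_mk]
          rw [← add_div, ← e3]
          field_simp
    · by_cases hv : v = 0
      · subst hv
        have hx : d₁ * u / d₃ ≠ 0 := div_ne_zero (mul_ne_zero h₁ hu) h₃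
        have hy : d₂ * u / d₃ ≠ 0 := div_ne_zero (mul_ne_zero h₂ hu) h₃
        refine ⟨_, m1 _ hx, _, m2 _ hy, ?_⟩
        ext
        · simp only [Prod.mk_add_mk]
          rw [← add_div, ← add_mul, ← e3]
          field_simp
        · simp only [Prod.mk_add_mk]
          have a1 : d₁ / (d₁ * u / d₃) = d₃ / u := by field_simp
          have a2 : d₂ / (d₂ * u / d₃) = d₃ / u := by field_simp
          rw [a1, a2, CharTwo.add_self_eq_zero]
      · rcases aux_AS hF (d₁ / (u * v)) (d₂ / (u * v)) with ⟨t, ht⟩ | ⟨t, ht⟩ | ⟨t, ht⟩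
        · obtain ⟨x, y, hx, hy, r1, r2⟩ := aux_rep d₁ u v t h₁ hu hv ht
          exact ⟨_, m1 x hx, _, m1 y hy, Prod.ext r1 r2⟩
        · obtain ⟨x, y, hx, hy, r1, r2⟩ := aux_rep d₂ u v t h₂ hu hv ht
          exact ⟨_, m2 x hx, _, m2 y hy, Prod.ext r1 r2⟩
        · rw [← add_div, ← e3] at ht
          obtain ⟨x, y, hx, hy, r1, r2⟩ := aux_rep d₃ u v t h₃ hu hv ht
          exact ⟨_, m3 x hx, _, m3 y hy, Prod.ext r1 r2⟩
  · intro g hg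
    refine aux_count ![d₁, d₂, d₃] ?_ S ?_ g hg
    · intro i
      fin_cases i <;> simpa
    · intro q hq
      rw [hS] at hq
      rcases hq with (h | h) | h
      · exact ⟨0, h⟩
      · exact ⟨1, h⟩
      · exact ⟨2, h⟩
end

section
/- Every abelian group of exponent 2 possesses a basis S such that every non-zero element of the group has at most 36 ordered representations as a sum of two elements of S. -/
/-- Every non-zero element has at most `n` representations, and `S` is a basis. -/
def GoodBasis (n : ℕ) {G : Type*} [AddCommGroup G] (S : Set G) : Prop :=
  (∀ g : G, ∃ a ∈ S, ∃ b ∈ S, a + b = g) ∧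
  (∀ g : G, g ≠ 0 → ∃ T : Finset (G × G), T.card ≤ n ∧
    ∀ p : G × G, p.1 ∈ S → p.2 ∈ S → p.1 + p.2 = g → p ∈ T)

open Polynomial in
lemma roots_bound {F : Type*} [Field F] [DecidableEq F] (a b d : F) (h : a ≠ 0 ∨ d ≠ 0) :
    ∃ R : Finset F, R.card ≤ 2 ∧ ∀ x, a * x ^ 2 + b * x + d = 0 → x ∈ R := by
  have h0 : (C a * X ^ 2 + C b * X + C d : F[X]) ≠ 0 := by
    intro h0
    rcases h with h | h
    · apply h
      have := congrArg (fun p => coeff p 2) h0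
      simpa [coeff_X, coeff_C] using this
    · apply h
      have := congrArg (fun p => coeff p 0) h0
      simpa [coeff_X, coeff_C] using this
  refine ⟨(C a * X ^ 2 + C b * X + C d : F[X]).roots.toFinset, ?_, ?_⟩
  · exact (Multiset.toFinset_card_le _).trans ((card_roots' _).trans natDegree_quadratic_le)
  · intro x hx
    rw [Multiset.mem_toFinset, mem_roots h0]
    simpa [IsRoot] using hx

lemma field_basis {F : Type*} [Field F] [CharP F 2] (c : F) (hc0 : c ≠ 0) (hc1 : 1 + c ≠ 0)
    (hP : ∀ a b : F, ∃ t : F, t ^ 2 + t = a ∨ t ^ 2 + t = b ∨ t ^ 2 + t = a + b) :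
    ∃ S : Set (F × F), GoodBasis 18 S := by
  classical
  have h2 : (2 : F) = 0 := CharTwo.two_eq_zero
  let K : Finset F := {1, c, 1 + c}
  have hK0 : ∀ k ∈ K, k ≠ 0 := by
    intro k hk
    simp only [K, Finset.mem_insert, Finset.mem_singleton] at hk
    rcases hk with rfl | rfl | rfl
    · exact one_ne_zero
    · exact hc0
    · exact hc1
  have h1K : 1 ∈ K := by simp [K]
  have hcK : c ∈ K := by simp [K]
  have hKc : K.card ≤ 3 := Finset.card_le_three
  refine ⟨{p | p.1 * p.2 ∈ K}, ?_, ?_⟩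
  · rintro ⟨u, v⟩
    by_cases hu : u = 0
    · by_cases hv : v = 0
      · refine ⟨(1, 1), by simpa using h1K, (1, 1), by simpa using h1K, ?_⟩
        ext <;> simp [hu, hv, CharTwo.add_self_eq_zero]
      · refine ⟨((1 + c) / v, v / (1 + c)), ?_, ((1 + c) / v, c * v / (1 + c)), ?_, ?_⟩
        · have : (1 + c) / v * (v / (1 + c)) = 1 := by field_simp
          simpa [this] using h1K
        · have : (1 + c) / v * (c * v / (1 + c)) = c := by field_simp
          simpa [this] using hcK
        · ext
          · simp [hu, CharTwo.add_self_eq_zero]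
          · simp only [Prod.snd_add]; field_simp
    · by_cases hv : v = 0
      · refine ⟨(u / (1 + c), (1 + c) / u), ?_, (c * u / (1 + c), (1 + c) / u), ?_, ?_⟩
        · have : u / (1 + c) * ((1 + c) / u) = 1 := by field_simp
          simpa [this] using h1K
        · have : c * u / (1 + c) * ((1 + c) / u) = c := by field_simp
          simpa [this] using hcK
        · ext
          · simp only [Prod.fst_add]; field_simp
          · simp [hv, CharTwo.add_self_eq_zero]
      · have key : ∃ k ∈ K, ∃ t : F, t ^ 2 + t = k / (u * v) := by
          obtain ⟨t, h | h | h⟩ := hP (1 / (u * v)) (c / (u * v))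
          · exact ⟨1, h1K, t, h⟩
          · exact ⟨c, hcK, t, h⟩
          · exact ⟨1 + c, by simp [K], t, by rw [h]; ring⟩
        obtain ⟨k, hk, t, ht⟩ := key
        have hk0 := hK0 k hk
        have hne : t * (t + 1) ≠ 0 := by
          have : t * (t + 1) = k / (u * v) := by rw [← ht]; ring
          rw [this]
          exact div_ne_zero hk0 (mul_ne_zero hu hv)
        have ht0 : t ≠ 0 := left_ne_zero_of_mul hne
        have ht1 : t + 1 ≠ 0 := right_ne_zero_of_mul hne
        have hkk : k = t * (t + 1) * u * v := by
          field_simp at ht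
          rw [← ht]
        refine ⟨(u * t, (t + 1) * v), ?_, (u * (t + 1), t * v), ?_, ?_⟩
        · have : u * t * ((t + 1) * v) = k := by rw [hkk]; ring
          simpa [this] using hk
        · have : u * (t + 1) * (t * v) = k := by rw [hkk]; ring
          simpa [this] using hk
        · ext
          · simp only [Prod.fst_add]; linear_combination u * t * h2
          · simp only [Prod.snd_add]; linear_combination v * t * h2
  · rintro ⟨u, v⟩ hg
    have hR : ∀ q : F × F, ∃ R : Finset F, R.card ≤ 2 ∧ (q.1 ∈ K → 
        ∀ x, v * x ^ 2 + (v * u + q.1 + q.2) * x + q.1 * u = 0 → x ∈ R) := by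
      rintro ⟨k, l⟩
      by_cases hk : k ∈ K
      · obtain ⟨R, h1, h3⟩ := roots_bound v (v * u + k + l) (k * u) (by
          by_cases hv : v = 0
          · right
            refine mul_ne_zero (hK0 k hk) ?_
            rintro rfl
            exact hg (by simp [hv])
          · exact Or.inl hv)
        exact ⟨R, h1, fun _ => h3⟩
      · exact ⟨∅, by simp, fun h => absurd h hk⟩
    choose R hR1 hR2 using hR
    refine ⟨(K ×ˢ K).biUnion fun q =>
      (R q).image fun x => ((x, q.1 / x), (u - x, q.2 / (u - x))), ?_, ?_⟩
    · refine (Finset.card_biUnion_le_card_mul _ _ 2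
        fun q _ => Finset.card_image_le.trans (hR1 q)).trans ?_
      rw [Finset.card_product]
      nlinarith
    · rintro ⟨⟨x, x'⟩, ⟨y, y'⟩⟩ h1 h3 h4
      simp only [Set.mem_ofPred_eq] at h1 h3
      simp only [Prod.mk_add_mk, Prod.mk.injEq] at h4
      obtain ⟨hu, hv⟩ := h4
      have hx : x ≠ 0 := left_ne_zero_of_mul (hK0 _ h1)
      have hy : y ≠ 0 := left_ne_zero_of_mul (hK0 _ h3)
      rw [Finset.mem_biUnion]
      refine ⟨(x * x', y * y'), Finset.mk_mem_product h1 h3, ?_⟩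
      rw [Finset.mem_image]
      refine ⟨x, hR2 (x * x', y * y') h1 x ?_, ?_⟩
      · subst hu hv
        linear_combination (2 * (x ^ 2 * x') + x ^ 2 * y' + x * y * x' + x * y * y') * h2
      · have : u - x = y := by rw [← hu]; ring
        simp [this, hx, hy]

lemma transfer {H G : Type*} [AddCommGroup H] [AddCommGroup G] (f : H →+ G)
    (hf : Function.Surjective f) (z : H) (hz : ∀ x, f x = 0 → x = 0 ∨ x = z)
    (h : ∃ S : Set H, GoodBasis 18 S) : ∃ S : Set G, GoodBasis 36 S := by
  classical
  obtain ⟨S, hS, hT⟩ := h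
  refine ⟨f '' S, ?_, ?_⟩
  · intro g
    obtain ⟨x, rfl⟩ := hf g
    obtain ⟨a, ha, b, hb, rfl⟩ := hS x
    exact ⟨f a, ⟨a, ha, rfl⟩, f b, ⟨b, hb, rfl⟩, (map_add f a b).symm⟩
  · intro g hg
    obtain ⟨x, rfl⟩ := hf g
    have hx : x ≠ 0 := by rintro rfl; simp at hg
    obtain ⟨T1, hT1, hT1'⟩ := hT x hx
    have hT2 : ∃ T : Finset (H × H), T.card ≤ 18 ∧
        (f z = 0 → ∀ p : H × H, p.1 ∈ S → p.2 ∈ S → p.1 + p.2 = x + z → p ∈ T) := by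
      by_cases hfz : f z = 0
      · have : x + z ≠ 0 := by
          intro h
          apply hg
          have := congrArg f h
          simpa [hfz] using this
        obtain ⟨T, h1, h2⟩ := hT _ this
        exact ⟨T, h1, fun _ => h2⟩
      · exact ⟨∅, by simp, fun h => absurd h hfz⟩
    obtain ⟨T2, hT2, hT2'⟩ := hT2
    refine ⟨(T1 ∪ T2).image (Prod.map f f), ?_, ?_⟩
    · refine Finset.card_image_le.trans ((Finset.card_union_le _ _).trans ?_)
      omega
    · rintro ⟨_, _⟩ ⟨a, ha, rfl⟩ ⟨b, hb, rfl⟩ hab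
      simp only at hab
      rw [Finset.mem_image]
      refine ⟨(a, b), ?_, rfl⟩
      rw [Finset.mem_union]
      have h0 : f (a + b - x) = 0 := by simp [hab]
      rcases hz _ h0 with h | h
      · left
        exact hT1' (a, b) ha hb (sub_eq_zero.mp h)
      · right
        refine hT2' (h ▸ h0) (a, b) ha hb ?_
        simp only
        rw [← h]; abel

lemma finite_AS {F : Type*} [Field F] [CharP F 2] [Finite F] (a b : F) :
    ∃ t : F, t ^ 2 + t = a ∨ t ^ 2 + t = b ∨ t ^ 2 + t = a + b := by
  classical
  have h2 : (2 : F) = 0 := CharTwo.two_eq_zero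
  let f : F →+ F :=
    { toFun := fun t => t ^ 2 + t
      map_zero' := by simp
      map_add' := fun x y => by linear_combination x * y * h2 }
  have hker : Nat.card f.ker ≤ 2 := by
    have hsub : (f.ker : Set F) ⊆ ({0, 1} : Set F) := by
      intro x hx
      have hx : x ^ 2 + x = 0 := hx
      have : x * (x + 1) = 0 := by rw [← hx]; ring
      rcases mul_eq_zero.mp this with h | h
      · simp [h]
      · right
        have : x = 1 := by linear_combination h - h2
        simpa using this
    have h3 := Set.ncard_le_ncard hsub
    rw [Set.ncard_pair zero_ne_one] at h3
    exact h3
  have hidx : f.range.index ≤ 2 := by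
    have h1 := f.range.card_mul_index
    have h3 := f.ker.card_mul_index
    rw [AddSubgroup.index_ker] at h3
    have hpos : 0 < Nat.card f.range := Nat.card_pos
    have : Nat.card f.range * f.range.index ≤ Nat.card f.range * 2 := by
      rw [h1, ← h3, mul_comm]
      exact Nat.mul_le_mul_left _ hker
    exact Nat.le_of_mul_le_mul_left this hpos
  have hmem : a ∈ f.range ∨ b ∈ f.range ∨ a + b ∈ f.range := by
    have hne : f.range.index ≠ 0 := AddSubgroup.index_ne_zero_of_finite
    have : f.range.index = 1 ∨ f.range.index = 2 := by omega
    rcases this with h | h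
    · left
      rw [AddSubgroup.index_eq_one] at h
      simp [h]
    · have := AddSubgroup.add_mem_iff_of_index_two h (a := a) (b := b)
      tauto
  rcases hmem with ⟨t, h⟩ | ⟨t, h⟩ | ⟨t, h⟩
  · exact ⟨t, Or.inl h⟩
  · exact ⟨t, Or.inr (Or.inl h)⟩
  · exact ⟨t, Or.inr (Or.inr h)⟩

lemma closed_AS {F : Type*} [Field F] [IsAlgClosed F] (a : F) : ∃ t : F, t ^ 2 + t = a := by
  open Polynomial in
  have hd : (C 1 * X ^ 2 + C 1 * X + C (-a) : F[X]).degree = 2 := degree_quadratic one_ne_zero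
  obtain ⟨t, ht⟩ := IsAlgClosed.exists_root _ (by rw [hd]; norm_num)
  refine ⟨t, ?_⟩
  simp [Polynomial.IsRoot] at ht
  linear_combination ht

lemma exists_c (F : Type*) [Field F] [CharP F 2] (h : 2 < ENat.card F) :
    ∃ c : F, c ≠ 0 ∧ 1 + c ≠ 0 := by
  by_contra! hc
  have hsub : (Set.univ : Set F) ⊆ {0, 1} := by
    intro x _
    by_cases hx : x = 0
    · simp [hx]
    · right
      have := hc x hx
      have h2 : (2 : F) = 0 := CharTwo.two_eq_zero
      have : x = 1 := by linear_combination this - h2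
      simpa using this
  have h3 := Set.encard_le_encard hsub
  rw [Set.encard_univ, Set.encard_pair zero_ne_one] at h3
  exact absurd h3 (not_le.mpr h)

lemma exists_field (G : Type*) [Infinite G] :
    ∃ (F : Type _) (_ : Field F) (_ : CharP F 2) (_ : IsAlgClosed F),
      Cardinal.mk F = Cardinal.mk G := by
  let P := MvPolynomial G (ZMod 2)
  let Q := FractionRing P
  have hP : Cardinal.mk P = Cardinal.mk G := by
    have h := MvPolynomial.cardinalMk_eq_max_lift (σ := G) (R := ZMod 2)
    have h2 : Cardinal.lift (Cardinal.mk (ZMod 2)) ≤ Cardinal.mk G := by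
      refine le_trans ?_ (Cardinal.aleph0_le_mk G)
      rw [Cardinal.lift_le_aleph0]
      exact Cardinal.mk_le_aleph0
    rw [h, Cardinal.lift_id', max_eq_right h2, max_eq_left (Cardinal.aleph0_le_mk G)]
  have hQ : Cardinal.mk Q = Cardinal.mk G := by
    rw [Cardinal.mk_fractionRing, hP]
  have : Infinite Q := by
    rw [Cardinal.infinite_iff, hQ]; exact Cardinal.aleph0_le_mk G
  haveI : CharP P 2 := inferInstance
  haveI : CharP Q 2 := inferInstance
  haveI : CharP (AlgebraicClosure Q) 2 := inferInstance
  refine ⟨AlgebraicClosure Q, inferInstance, inferInstance, inferInstance, ?_⟩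
  rw [← hQ]
  refine le_antisymm ?_ (Cardinal.mk_le_of_injective (algebraMap Q (AlgebraicClosure Q)).injective)
  have := Algebra.IsAlgebraic.cardinalMk_le_max Q (AlgebraicClosure Q)
  rwa [max_eq_left (Cardinal.aleph0_le_mk Q)] at this

lemma good_basis_exists {G : Type*} [AddCommGroup G] (hexp : ∀ g : G, g + g = 0) :
    ∃ S : Set G, GoodBasis 36 S := by
  classical
  letI : Module (ZMod 2) G := AddCommGroup.zmodModule (n := 2) (fun g => by rw [two_nsmul, hexp])
  rcases finite_or_infinite G with hfin | hinf
  · set n := Module.finrank (ZMod 2) G with hn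
    by_cases hsmall : n ≤ 2
    · haveI := Fintype.ofFinite G
      refine ⟨Set.univ, fun g => ⟨g, trivial, 0, trivial, by simp⟩, fun g _ =>
        ⟨Finset.univ.image fun x => (x, g - x), ?_, ?_⟩⟩
      · refine Finset.card_image_le.trans ?_
        rw [Finset.card_univ, Module.card_eq_pow_finrank (K := ZMod 2), ZMod.card, ← hn]
        calc 2 ^ n ≤ 2 ^ 2 := Nat.pow_le_pow_right (by norm_num) hsmall
          _ ≤ 36 := by norm_num
      · rintro ⟨a, b⟩ _ _ h
        simp only at h
        simp [← h]
    · obtain ⟨m, hm⟩ : ∃ m, n = 2 * m ∨ n + 1 = 2 * m := ⟨(n + 1) / 2, by omega⟩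
      have hm0 : m ≠ 0 := by omega
      have hF : Module.finrank (ZMod 2) (GaloisField 2 m) = m := GaloisField.finrank 2 hm0
      haveI : Finite (GaloisField 2 m) := inferInstance
      obtain ⟨c, hc0, hc1⟩ := exists_c (GaloisField 2 m) (by
        rw [ENat.card_eq_coe_natCard, GaloisField.card 2 m hm0]
        have : 2 ^ 2 ≤ 2 ^ m := Nat.pow_le_pow_right (by norm_num) (by omega)
        exact_mod_cast (by omega : 2 < 2 ^ m))
      have hB := field_basis c hc0 hc1 finite_AS
      rcases hm with hm | hm
      · have e : (GaloisField 2 m × GaloisField 2 m) ≃ₗ[ZMod 2] G :=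
          LinearEquiv.ofFinrankEq _ _ (by rw [Module.finrank_prod, hF]; omega)
        exact transfer e.toLinearMap.toAddMonoidHom e.surjective 0
          (fun x hx => Or.inl (by simpa using hx)) hB
      · have e : (GaloisField 2 m × GaloisField 2 m) ≃ₗ[ZMod 2] (G × ZMod 2) :=
          LinearEquiv.ofFinrankEq _ _ (by
            rw [Module.finrank_prod, Module.finrank_prod, hF, Module.finrank_self]; omega)
        refine transfer ((LinearMap.fst (ZMod 2) G (ZMod 2)).comp e.toLinearMap).toAddMonoidHom
          (Prod.fst_surjective.comp e.surjective) (e.symm (0, 1)) ?_ hB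
        intro x hx
        have hx : (e x).1 = 0 := hx
        have h01 : ∀ t : ZMod 2, t = 0 ∨ t = 1 := by decide
        rcases h01 (e x).2 with h | h
        · left
          rw [← e.map_eq_zero_iff]
          exact Prod.ext hx h
        · right
          rw [LinearEquiv.eq_symm_apply]
          exact Prod.ext hx h
  · obtain ⟨F, _, _, _, hF⟩ := exists_field G
    haveI : Infinite F := by
      rw [Cardinal.infinite_iff, hF]; exact Cardinal.aleph0_le_mk G
    obtain ⟨c, hc0, hc1⟩ := exists_c F (by rw [ENat.card_eq_top_of_infinite]; exact ENat.natCast_lt_top 2)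
    have hB := field_basis c hc0 hc1 (fun a _ => (closed_AS a).imp fun _ h => Or.inl h)
    letI : Algebra (ZMod 2) F := ZMod.algebra F 2
    have hr : ∀ (V : Type _) [AddCommGroup V] [Module (ZMod 2) V] [Infinite V],
        Module.rank (ZMod 2) V = Cardinal.mk V := by
      intro V _ _ _
      let b := Module.Basis.ofVectorSpace (ZMod 2) V
      have hι : Infinite (Module.Basis.ofVectorSpaceIndex (ZMod 2) V) := by
        by_contra hfin
        rw [not_infinite_iff_finite] at hfin
        have : Finite V := Finite.of_equiv _ b.equivFun.toEquiv.symm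
        exact not_finite V
      rw [← b.mk_eq_rank'', Cardinal.mk_congr b.repr.toEquiv, Cardinal.mk_finsupp_lift_of_infinite,
        Cardinal.lift_id']
      refine (max_eq_left ?_).symm
      refine le_trans ?_ (Cardinal.aleph0_le_mk _)
      rw [Cardinal.lift_le_aleph0]
      exact Cardinal.mk_le_aleph0
    have e : Nonempty ((F × F) ≃ₗ[ZMod 2] G) := by
      apply nonempty_linearEquiv_of_rank_eq
      rw [hr, hr, Cardinal.mk_prod]
      simp [hF]
    obtain ⟨e⟩ := e
    exact transfer e.toLinearMap.toAddMonoidHom e.surjective 0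
      (fun x hx => Or.inl (by simpa using hx)) hB

/-- every abelian group of exponent 2 has a basis `S` such that
every non-zero element has at most 36 ordered representations as a sum of two
elements of `S`. -/
theorem stmt_16 {G : Type*} [AddCommGroup G] (hexp : ∀ g : G, g + g = 0) :
    ∃ S : Set G,
      (∀ g : G, ∃ a ∈ S, ∃ b ∈ S, a + b = g) ∧
      (∀ g : G, g ≠ 0 →
        Cardinal.mk {p : G × G // p.1 ∈ S ∧ p.2 ∈ S ∧ p.1 + p.2 = g} ≤ 36) := by
  obtain ⟨S, h1, h2⟩ := good_basis_exists hexp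
  refine ⟨S, h1, fun g hg => ?_⟩
  obtain ⟨T, hT, hT'⟩ := h2 g hg
  have h3 : Cardinal.mk {p : G × G // p.1 ∈ S ∧ p.2 ∈ S ∧ p.1 + p.2 = g} ≤
      Cardinal.mk {p : G × G // p ∈ T} :=
    Cardinal.mk_subtype_mono (fun p hp => hT' p hp.1 hp.2.1 hp.2.2)
  refine h3.trans ?_
  rw [Cardinal.mk_fintype, Fintype.card_coe]
  exact_mod_cast hT
end
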